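/- For every k ≥ 3 and every n ≥ k there exists an unweighted connected graph G on n vertices and a collection of k singleton groups R_1 = {r_1}, …, R_k = {r_k} such that every group Steiner preserver of G has at least (n−k)·⌊k/3⌋ edges. Concretely, take G to consist of a cycle ⟨r_1, r_2, …, r_k, r_1⟩ on the k required vertices together with n−k additional vertices v_1, …, v_{n−k}, where each v_i is adjacent exactly to the vertices r_{1+3(j−1)} for j = 1, …, ⌊k/3⌋; then every group Steiner preserver of G must contain all of the (n−k)·⌊k/3⌋ edges (v_i, r_{1+3(j−1)}). -/

import Mathlib

open SimpleGraph ENNReal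

/-- The length (total weight) of a walk: the sum of its edge weights, with multiplicity. -/
def walkWeight {V : Type*} {G : SimpleGraph V} (w : V → V → ℝ) {u v : V} (p : G.Walk u v) : ℝ :=
  (p.darts.map (fun d => w d.toProd.1 d.toProd.2)).sum

/-- A walk is a group Steiner path w.r.t. the groups `R` if it visits at least one
vertex of every group. -/
def IsGroupSteiner {V : Type*} {G : SimpleGraph V} {k : ℕ} (R : Fin k → Set V) {u v : V}
    (p : G.Walk u v) : Prop :=
  ∀ i, ∃ x ∈ R i, x ∈ p.support

/-- The group Steiner distance: the infimum of the lengths of group Steiner paths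
from `s` to `t` (`∞` if there is none). -/
noncomputable def gsDist {V : Type*} (G : SimpleGraph V) (w : V → V → ℝ) {k : ℕ}
    (R : Fin k → Set V) (s t : V) : ℝ≥0∞ :=
  ⨅ p : {p : G.Walk s t // IsGroupSteiner R p}, ENNReal.ofReal (walkWeight w p.1)

/-- The ordinary shortest-path distance: the infimum of the lengths of walks
from `s` to `t` (`∞` if there is none). -/
noncomputable def spDist {V : Type*} (G : SimpleGraph V) (w : V → V → ℝ) (s t : V) : ℝ≥0∞ :=
  ⨅ p : G.Walk s t, ENNReal.ofReal (walkWeight w p)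

/-- Adjacency rule (on vertex numbers): the required vertices `0, …, k-1` form a cycle, and every
other vertex is joined to the required vertices `0, 3, …, 3 (k / 3 - 1)`. -/
def lbRel (k x y : ℕ) : Prop :=
  (x < k ∧ y < k ∧ (y = x + 1 ∨ (x = 0 ∧ y = k - 1))) ∨ (k ≤ x ∧ y < 3 * (k / 3) ∧ 3 ∣ y)

/-- The lower bound graph. -/
def lbGraph (k n : ℕ) : SimpleGraph (Fin n) :=
  SimpleGraph.fromRel (fun x y : Fin n => lbRel k x y)

/-- A sequence of `k + 1` vertices covering all required ones, from an additional vertex to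
`j + 1`, must visit `j` first. -/
lemma lb_core (k j : ℕ) (g : ℕ → ℕ) (h0 : k ≤ g 0) (hk : g k = j + 1) (hj : j + 2 < k)
    (hj3 : 3 ∣ j) (hadj : ∀ i < k, lbRel k (g i) (g (i+1)) ∨ lbRel k (g (i+1)) (g i))
    (hcov : ∀ x < k, ∃ i ≤ k, g i = x) : g 1 = j := by
  have hsub : Finset.range k ⊆ (Finset.Icc 1 k).image g := by
    intro x hx
    rw [Finset.mem_range] at hx
    obtain ⟨i, hi, rfl⟩ := hcov x hx
    refine Finset.mem_image_of_mem _ (Finset.mem_Icc.2 ⟨?_, hi⟩)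
    rcases Nat.eq_zero_or_pos i with rfl | h
    · omega
    · exact h
  have hle : ((Finset.Icc 1 k).image g).card ≤ k := by
    simpa using Finset.card_image_le (s := Finset.Icc 1 k) (f := g)
  have heq : Finset.range k = (Finset.Icc 1 k).image g :=
    Finset.eq_of_subset_of_card_le hsub (by simpa using hle)
  have hinj : Set.InjOn g (Finset.Icc 1 k : Finset ℕ) := by
    rw [← Finset.card_image_iff, ← heq]; simp
  have hinj' : ∀ a b, 1 ≤ a → a ≤ k → 1 ≤ b → b ≤ k → g a = g b → a = b := by
    intro a b h1 h2 h3 h4 h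
    exact hinj (by simp [h1, h2]) (by simp [h3, h4]) h
  have hlt : ∀ a, 1 ≤ a → a ≤ k → g a < k := by
    intro a h1 h2
    have : g a ∈ Finset.range k := by
      rw [heq]; exact Finset.mem_image_of_mem _ (Finset.mem_Icc.2 ⟨h1, h2⟩)
    simpa using this
  -- a vertex next to `j + 1` is either first, or second to last
  have key : ∀ x, (x = j ∨ x = j + 2) → ∀ i, 2 ≤ i → i ≤ k → g i = x → i + 1 = k := by
    intro x hx i hi hik hgi
    have hne : i ≠ k := by rintro rfl; omega
    have a1 := hadj (i-1) (by omega)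
    have a2 := hadj i (by omega)
    rw [show i - 1 + 1 = i by omega] at a1
    have l1 := hlt (i-1) (by omega) (by omega)
    have l2 := hlt (i+1) (by omega) (by omega)
    have l3 := hlt i (by omega) (by omega)
    have d : g (i-1) ≠ g (i+1) := fun h => by
      have := hinj' _ _ (by omega) (by omega) (by omega) (by omega) h
      omega
    have d1 : g (i-1) ≠ g k := fun h => by
      have := hinj' _ _ (by omega) (by omega) (by omega) (by omega) h
      omega
    have e : g (i+1) = g k := by
      unfold lbRel at a1 a2
      omega
    exact hinj' _ _ (by omega) (by omega) (by omega) (by omega) e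
  obtain ⟨a, ha, hga⟩ := hcov j (by omega)
  obtain ⟨b, hb, hgb⟩ := hcov (j+2) (by omega)
  have a0 : a ≠ 0 := by rintro rfl; omega
  have b0 : b ≠ 0 := by rintro rfl; omega
  have b1 : b ≠ 1 := by
    rintro rfl
    have := hadj 0 (by omega)
    simp only [zero_add] at this
    unfold lbRel at this
    omega
  by_cases a1 : a = 1
  · rw [← a1]; exact hga
  have := key j (Or.inl rfl) a (by omega) ha hga
  have := key (j+2) (Or.inr rfl) b (by omega) hb hgb
  have : a = b := by omega
  subst this
  omega

/-- A sequence of consecutively adjacent vertices gives a walk. -/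
lemma lb_walk {V : Type*} (G : SimpleGraph V) (f : ℕ → V) :
    ∀ m : ℕ, (∀ i < m, G.Adj (f i) (f (i+1))) →
      ∃ p : G.Walk (f 0) (f m), p.length = m ∧ ∀ i ≤ m, f i ∈ p.support := by
  intro m
  induction m with
  | zero => intro _; exact ⟨.nil, rfl, by intro i hi; simp [Nat.le_zero.1 hi]⟩
  | succ m ih =>
    intro h
    obtain ⟨p, hp, hs⟩ := ih (fun i hi => h i (by omega))
    refine ⟨p.concat (h m (by omega)), by simp [hp], ?_⟩
    intro i hi
    rw [SimpleGraph.Walk.support_concat]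
    rcases Nat.lt_or_ge m i with h1 | h1
    · have : i = m + 1 := by omega
      subst this; simp
    · simp [hs i h1]

lemma lb_weight {V : Type*} {G : SimpleGraph V} {u v : V} (p : G.Walk u v) :
    walkWeight (fun _ _ => (1 : ℝ)) p = p.length := by
  simp [walkWeight]

lemma lb_adj {k n : ℕ} (hk : 3 ≤ k) (x y : Fin n) :
    (lbGraph k n).Adj x y ↔ lbRel k x y ∨ lbRel k y x := by
  unfold lbGraph
  rw [SimpleGraph.fromRel_adj]
  refine ⟨fun h => h.2, fun h => ⟨?_, h⟩⟩
  rintro rfl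
  unfold lbRel at h
  omega

lemma lb_connected {k n : ℕ} (hk : 3 ≤ k) (hn : k ≤ n) : (lbGraph k n).Connected := by
  have h : ∀ m, ∀ hm : m < n, (lbGraph k n).Reachable ⟨m, hm⟩ ⟨0, by omega⟩ := by
    intro m
    induction m with
    | zero => intro _; exact SimpleGraph.Reachable.refl _
    | succ m ih =>
      intro hm
      by_cases hmk : m + 1 < k
      · refine SimpleGraph.Reachable.trans (SimpleGraph.Adj.reachable ?_) (ih (by omega))
        rw [lb_adj hk]
        exact Or.inr (Or.inl ⟨by simp only; omega, by simp only; omega, Or.inl rfl⟩)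
      · refine SimpleGraph.Adj.reachable ?_
        rw [lb_adj hk]; unfold lbRel; simp only; omega
  have : Nonempty (Fin n) := ⟨⟨0, by omega⟩⟩
  exact SimpleGraph.Connected.mk fun x y => (h x x.2).trans (h y y.2).symm

/-- The graph has a group Steiner path of length `k` from `v` to `j + 1`. -/
lemma lb_upper {k n : ℕ} (hk : 3 ≤ k) (hn : k ≤ n) (j : ℕ) (hj : j + 2 < k) (hj3 : 3 ∣ j)
    (v : Fin n) (hv : k ≤ v.val) :
    gsDist (lbGraph k n) (fun _ _ => (1 : ℝ)) (fun i : Fin k => {Fin.castLE hn i}) v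
      ⟨j + 1, by omega⟩ ≤ (k : ℝ≥0∞) := by
  let f : ℕ → Fin n := fun i => if h0 : i = 0 then v else if h : i ≤ j + 1 then ⟨j + 1 - i, by omega⟩
    else ⟨k + j + 1 - i, by omega⟩
  have f0 : f 0 = v := by simp [f]
  have fval : ∀ i, i ≠ 0 → (f i).val = if i ≤ j + 1 then j + 1 - i else k + j + 1 - i := by
    intro i hi
    simp only [f, hi, dite_false]
    split_ifs <;> rfl
  have fk : f k = ⟨j + 1, by omega⟩ := by
    apply Fin.ext
    rw [fval k (by omega)]
    simp only
    split_ifs <;> omega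
  obtain ⟨p, hp, hs⟩ := lb_walk (lbGraph k n) f k (by
    intro i hi
    rw [lb_adj hk]
    rcases Nat.eq_zero_or_pos i with rfl | h
    · rw [f0, fval _ (by omega)]
      unfold lbRel
      split_ifs <;> omega
    · rw [fval _ (by omega), fval _ (by omega)]
      unfold lbRel
      split_ifs <;> omega)
  have hst : IsGroupSteiner (fun i : Fin k => {Fin.castLE hn i}) p := by
    intro i
    refine ⟨_, rfl, ?_⟩
    have hi := i.2
    have : ∃ a ≤ k, f a = Fin.castLE hn i := by
      by_cases h : i.val ≤ j
      · refine ⟨j + 1 - i, by omega, Fin.ext ?_⟩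
        rw [fval _ (by omega)]
        simp only [Fin.val_castLE]
        split_ifs <;> omega
      · refine ⟨k + j + 1 - i, by omega, Fin.ext ?_⟩
        rw [fval _ (by omega)]
        simp only [Fin.val_castLE]
        split_ifs <;> omega
    obtain ⟨a, ha, h⟩ := this
    rw [← h]; exact hs a ha
  rw [← fk, ← f0]
  refine (iInf_le _ (⟨p, hst⟩ : {p : (lbGraph k n).Walk (f 0) (f k) // _})).trans ?_
  simp [lb_weight, hp]

/-- Every preserver contains every edge between an additional and a required vertex. -/
lemma lb_edge {k n : ℕ} (hk : 3 ≤ k) (hn : k ≤ n) (H : SimpleGraph (Fin n))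
    (hH : H ≤ lbGraph k n)
    (hd : ∀ s t : Fin n, gsDist H (fun _ _ => (1 : ℝ)) (fun i : Fin k => {Fin.castLE hn i}) s t
      = gsDist (lbGraph k n) (fun _ _ => (1 : ℝ)) (fun i : Fin k => {Fin.castLE hn i}) s t)
    (j : ℕ) (hj : j + 2 < k) (hj3 : 3 ∣ j) (v : Fin n) (hv : k ≤ v.val) :
    H.Adj v ⟨j, by omega⟩ := by
  have h1 := lb_upper hk hn j hj hj3 v hv
  rw [← hd] at h1
  have h2 := lt_of_le_of_lt h1 (show (k : ℝ≥0∞) < ((k + 1 : ℕ) : ℝ≥0∞) by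
    exact_mod_cast Nat.lt_succ_self k)
  unfold gsDist at h2
  rw [iInf_lt_iff] at h2
  obtain ⟨⟨p, hp⟩, h3⟩ := h2
  rw [lb_weight, ENNReal.ofReal_natCast] at h3
  have hlen : p.length ≤ k := by
    have : p.length < k + 1 := by exact_mod_cast h3
    omega
  have hcov : ∀ x < k, ∃ i ≤ p.length, (p.getVert i).val = x := by
    intro x hx
    obtain ⟨y, rfl, hy⟩ := hp ⟨x, hx⟩
    obtain ⟨i, hi, hil⟩ := SimpleGraph.Walk.mem_support_iff_exists_getVert.1 hy
    exact ⟨i, hil, by rw [hi]; rfl⟩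
  have hlen' : k ≤ p.length := by
    have hsub : Finset.range k ⊆ (Finset.Icc 1 p.length).image (fun i => (p.getVert i).val) := by
      intro x hx
      rw [Finset.mem_range] at hx
      obtain ⟨i, hi, rfl⟩ := hcov x hx
      refine Finset.mem_image.2 ⟨i, Finset.mem_Icc.2 ⟨?_, hi⟩, rfl⟩
      rcases Nat.eq_zero_or_pos i with rfl | h
      · rw [SimpleGraph.Walk.getVert_zero] at hx; omega
      · exact h
    have := (Finset.card_le_card hsub).trans Finset.card_image_le
    simpa using this
  have hlk : p.length = k := le_antisymm hlen hlen'
  have h1 : (p.getVert 1).val = j := by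
    refine lb_core k j (fun i => (p.getVert i).val) ?_ ?_ hj hj3 ?_ ?_
    · simpa using hv
    · simp only [← hlk, SimpleGraph.Walk.getVert_length]
    · intro i hi
      exact (lb_adj hk _ _).1 (hH (p.adj_getVert_succ (by omega)))
    · rw [hlk] at hcov; exact hcov
  have h4 := p.adj_getVert_succ (i := 0) (by omega)
  rw [SimpleGraph.Walk.getVert_zero] at h4
  have h5 : p.getVert (0 + 1) = ⟨j, by omega⟩ := Fin.ext h1
  rwa [h5] at h4

/-- Lower bound: for every `k ≥ 3` and `n ≥ k` there is an unweighted
connected graph on `n` vertices with `k` singleton groups such that every group Steiner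
preserver has at least `(n-k)·⌊k/3⌋` edges. -/
theorem stmt_6 :
    ∀ k : ℕ, 3 ≤ k → ∀ n : ℕ, k ≤ n →
    ∃ (G : SimpleGraph (Fin n)) (r : Fin k → Fin n),
      G.Connected ∧
      ∀ H : SimpleGraph (Fin n), H ≤ G →
        (∀ s t : Fin n, gsDist H (fun _ _ => (1 : ℝ)) (fun i => {r i}) s t
          = gsDist G (fun _ _ => (1 : ℝ)) (fun i => {r i}) s t) →
        (n - k) * (k / 3) ≤ H.edgeSet.ncard := by
  intro k hk n hn
  refine ⟨lbGraph k n, Fin.castLE hn, lb_connected hk hn, ?_⟩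
  intro H hH hd
  let F : Fin (n - k) × Fin (k / 3) → Sym2 (Fin n) := fun q =>
    s(⟨k + q.1, by omega⟩, ⟨3 * q.2, by omega⟩)
  have hF : Function.Injective F := by
    rintro ⟨a, b⟩ ⟨c, d⟩ h
    simp only [F, Sym2.eq_iff, Fin.mk.injEq] at h
    have := b.2
    have := d.2
    refine Prod.ext (Fin.ext ?_) (Fin.ext ?_) <;> simp only <;> omega
  have hsub : Set.range F ⊆ H.edgeSet := by
    rintro _ ⟨q, rfl⟩
    rw [SimpleGraph.mem_edgeSet]
    have := q.2.2
    exact lb_edge hk hn H hH hd (3 * q.2) (by omega) (by omega) ⟨k + q.1, by omega⟩ (by simp)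
  have h1 := Set.ncard_le_ncard hsub (Set.toFinite _)
  rw [← Set.image_univ, Set.ncard_image_of_injective _ hF, Set.ncard_univ] at h1
  simpa using h1
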